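/- Let (X, d) be a metric space with bounded geometry which is a coarse disjoint union of a sequence {X_n} of asymptotic expanders (finite nonempty metric spaces with |X_n| → ∞). Then X is not uniformly locally amenable. -/

import Mathlib

noncomputable section

namespace QL

variable {X : Type*}

/-- `X` has bounded geometry: closed balls of each fixed radius have uniformly bounded
(finite) cardinality. -/
def BoundedGeometry (X : Type*) [MetricSpace X] : Prop :=
  ∀ R : ℝ, 0 < R → ∃ C : ℕ, ∀ x : X,
    (Metric.closedBall x R).Finite ∧ (Metric.closedBall x R).ncard ≤ C

/-- `X` is a coarse disjoint union of the sequence of pieces `Xn`: the pieces partition `X`,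
are nonempty, and `d(Xn, Xm) → ∞` as `n + m → ∞` with `n ≠ m` (each piece carries the
restriction of the metric of `X`). -/
def IsCoarseDisjointUnion [MetricSpace X] (Xn : ℕ → Finset X) : Prop :=
  (∀ x : X, ∃! n : ℕ, x ∈ Xn n) ∧
  (∀ n : ℕ, (Xn n).Nonempty) ∧
  (∀ K : ℝ, ∃ N : ℕ, ∀ m n : ℕ, m ≠ n → N ≤ m + n →
    ∀ x ∈ Xn m, ∀ y ∈ Xn n, K ≤ dist x y)

/-- The outer `R`-boundary of `A` taken inside the subspace `Xn`:
`{x ∈ Xn \ A : d(x, A) ≤ R}`. -/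
def outBdry [MetricSpace X] (Xn A : Finset X) (R : ℝ) : Finset X :=
  letI := Classical.propDecidable
  Xn.filter fun x => x ∉ A ∧ ∃ a ∈ A, dist x a ≤ R

/-- A sequence of pieces `Xn` (each carrying the restriction of the ambient metric) is a
sequence of asymptotic expanders: for every `α > 0` there are `c ∈ (0,1)` and `R > 0` such
that every `A ⊆ Xn` with `α|Xn| ≤ |A| ≤ |Xn|/2` satisfies `|∂_R A| > c|A|`,
boundaries being taken inside `Xn`. -/
def IsAsymptoticExpanderSeq [MetricSpace X] (Xn : ℕ → Finset X) : Prop :=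
  ∀ α : ℝ, 0 < α → ∃ c ∈ Set.Ioo (0 : ℝ) 1, ∃ R : ℝ, 0 < R ∧
    ∀ n : ℕ, ∀ A : Finset X, A ⊆ Xn n →
      α * ((Xn n).card : ℝ) ≤ (A.card : ℝ) → (A.card : ℝ) ≤ ((Xn n).card : ℝ) / 2 →
      c * (A.card : ℝ) < ((outBdry (Xn n) A R).card : ℝ)

end QL

namespace QL

/-- The outer `R`-boundary `∂_R E = {x ∈ X ∖ E : d(x,E) ≤ R}` of a subset of a metric
space. -/
def setBdry {X : Type*} [MetricSpace X] (R : ℝ) (E : Set X) : Set X :=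
  {x : X | x ∉ E ∧ ∃ a ∈ E, dist x a ≤ R}

/-- `X` is uniformly locally amenable (ULA): for all `R, ε > 0` there is `S > 0` such that
for every finite `F ⊆ X` there is a (bounded) set `E` with `diam E ≤ S` and
`|∂_R E ∩ F| < ε|E ∩ F|`. -/
def ULA (X : Type*) [MetricSpace X] : Prop :=
  ∀ R : ℝ, 0 < R → ∀ ε : ℝ, 0 < ε → ∃ S : ℝ, 0 < S ∧
    ∀ F : Set X, F.Finite → ∃ E : Set X, Bornology.IsBounded E ∧ Metric.diam E ≤ S ∧
      ((setBdry R E ∩ F).ncard : ℝ) < ε * ((E ∩ F).ncard : ℝ)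

end QL

namespace QL

/-- `B` collects the `R`-boundary of `A` inside `Y`, and has at most `c * |A|` elements. -/
structure IsAlmostClosed {X : Type*} [MetricSpace X] (Y : Finset X) (R c : ℝ)
    (A B : Finset X) : Prop where
  subset : A ⊆ Y
  card_le : (B.card : ℝ) ≤ c * A.card
  outBdry_subset : outBdry Y A R ⊆ B

theorem mem_outBdry {X : Type*} [MetricSpace X] {Y A : Finset X} {R : ℝ} {x : X} :
    x ∈ outBdry Y A R ↔ x ∈ Y ∧ x ∉ A ∧ ∃ a ∈ A, dist x a ≤ R := by
  simp [outBdry]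

/-- An almost closed set that is not too large can be enlarged by a bounded amount. -/
theorem IsAlmostClosed.exists_larger {X : Type*} [MetricSpace X] {Y A B : Finset X}
    {R c S : ℝ} {C : ℕ} (h : IsAlmostClosed Y R c A B)
    (hC : ∀ x : X, (Metric.closedBall x S).Finite ∧ (Metric.closedBall x S).ncard ≤ C)
    (hU : ∀ F : Set X, F.Finite → F.Nonempty → ∃ E : Set X, Bornology.IsBounded E ∧
      Metric.diam E ≤ S ∧ ((setBdry R E ∩ F).ncard : ℝ) < c * ((E ∩ F).ncard : ℝ))
    (hc : 0 < c) (hlt : (1 + c) * (A.card : ℝ) < Y.card) :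
    ∃ A' B', IsAlmostClosed Y R c A' B' ∧ A.card < A'.card ∧ A'.card ≤ A.card + C := by
  classical
  set F : Finset X := Y \ (A ∪ B) with hF
  have hFne : F.Nonempty := by
    rw [hF, Finset.sdiff_nonempty]
    intro hsub
    have h₁ : (Y.card : ℝ) ≤ A.card + B.card := by
      exact_mod_cast (Finset.card_le_card hsub).trans (Finset.card_union_le A B)
    linarith [h.card_le]
  obtain ⟨E, hEb, hEd, hE⟩ := hU F F.finite_toSet (by simpa using hFne)
  set P : Finset X := F.filter (· ∈ E) with hP
  set Q : Finset X := F.filter (· ∈ setBdry R E) with hQ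
  have hPE : (E ∩ (F : Set X)).ncard = P.card := by
    rw [← Set.ncard_coe_finset]
    congr 1
    ext x
    simp [hP, and_comm]
  have hQE : (setBdry R E ∩ (F : Set X)).ncard = Q.card := by
    rw [← Set.ncard_coe_finset]
    congr 1
    ext x
    simp [hQ, and_comm]
  rw [hPE, hQE] at hE
  have hPpos : 0 < P.card := by
    have : (0 : ℝ) < c * P.card := (Nat.cast_nonneg _).trans_lt hE
    exact_mod_cast pos_of_mul_pos_right this hc.le
  obtain ⟨p, hp⟩ := Finset.card_pos.mp hPpos
  have hPC : P.card ≤ C := by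
    rw [← Set.ncard_coe_finset]
    refine (Set.ncard_le_ncard (fun x hx => ?_) (hC p).1).trans (hC p).2
    exact (Metric.dist_le_diam_of_mem hEb (Finset.mem_filter.mp hx).2
      (Finset.mem_filter.mp hp).2).trans hEd
  have hdisj : Disjoint A P := by
    rw [Finset.disjoint_left]
    intro x hxA hxP
    simp [hP, hF, hxA] at hxP
  have hcard : (A ∪ P).card = A.card + P.card := Finset.card_union_of_disjoint hdisj
  refine ⟨A ∪ P, B ∪ Q, ⟨?_, ?_, ?_⟩, by omega, by omega⟩
  · exact Finset.union_subset h.subset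
      ((Finset.filter_subset _ _).trans Finset.sdiff_subset)
  · have h₁ : ((B ∪ Q).card : ℝ) ≤ B.card + Q.card := by
      exact_mod_cast Finset.card_union_le B Q
    rw [hcard]
    push_cast
    linarith [h.card_le]
  · intro x hx
    obtain ⟨hxY, hxn, a, ha, hxa⟩ := mem_outBdry.mp hx
    rw [Finset.mem_union, not_or] at hxn
    rw [Finset.mem_union]
    rcases Finset.mem_union.mp ha with ha | ha
    · exact Or.inl (h.outBdry_subset (mem_outBdry.mpr ⟨hxY, hxn.1, a, ha, hxa⟩))
    · by_cases hxB : x ∈ B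
      · exact Or.inl hxB
      · have hxF : x ∈ F := by simp [hF, hxY, hxn.1, hxB]
        refine Or.inr (Finset.mem_filter.mpr ⟨hxF, fun hxE => hxn.2 ?_, a, ?_, hxa⟩)
        · exact Finset.mem_filter.mpr ⟨hxF, hxE⟩
        · exact (Finset.mem_filter.mp ha).2

/-- Asymptotic expanders of bounded geometry violate uniform local amenability, even when only
nonempty test sets are considered (for the empty test set the inequality never holds). -/
theorem IsAsymptoticExpanderSeq.not_forall_nonempty {X : Type*} [MetricSpace X]
    (hbg : BoundedGeometry X) {Xn : ℕ → Finset X}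
    (hgrow : Filter.Tendsto (fun n => (Xn n).card) Filter.atTop Filter.atTop)
    (hexp : IsAsymptoticExpanderSeq Xn) :
    ¬ ∀ R : ℝ, 0 < R → ∀ ε : ℝ, 0 < ε → ∃ S : ℝ, 0 < S ∧
      ∀ F : Set X, F.Finite → F.Nonempty → ∃ E : Set X, Bornology.IsBounded E ∧
        Metric.diam E ≤ S ∧
        ((setBdry R E ∩ F).ncard : ℝ) < ε * ((E ∩ F).ncard : ℝ) := by
  classical
  intro hU
  obtain ⟨c, ⟨hc, hc1⟩, R, hR, hA⟩ := hexp (1 / 4) (by norm_num)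
  obtain ⟨S, hS, hE⟩ := hU R hR c hc
  obtain ⟨C, hC⟩ := hbg S hS
  obtain ⟨n, hn⟩ := (hgrow.eventually_ge_atTop (4 * C + 1)).exists
  have hnR : 4 * (C : ℝ) + 1 ≤ (Xn n).card := by exact_mod_cast hn
  let T := (Xn n).powerset.filter fun A =>
    (A.card : ℝ) ≤ (Xn n).card / 2 ∧ ∃ B, IsAlmostClosed (Xn n) R c A B
  have hT : T.Nonempty := by
    refine ⟨∅, Finset.mem_filter.mpr ⟨by simp, by simp; positivity, ∅, by simp, by simp, ?_⟩⟩
    intro x hx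
    simp [mem_outBdry] at hx
  obtain ⟨A, hAT, hmax⟩ := T.exists_max_image Finset.card hT
  obtain ⟨hAX, hhalf, B, hAB⟩ := Finset.mem_filter.mp hAT
  by_cases hq : 1 / 4 * ((Xn n).card : ℝ) ≤ A.card
  · have h₁ := hA n A hAB.subset hq hhalf
    have h₂ : ((outBdry (Xn n) A R).card : ℝ) ≤ B.card := by
      exact_mod_cast Finset.card_le_card hAB.outBdry_subset
    linarith [hAB.card_le]
  · push Not at hq
    obtain ⟨A', B', hA', hlt, hle⟩ := hAB.exists_larger hC hE hc
      (by nlinarith [(Nat.cast_nonneg A.card : (0 : ℝ) ≤ A.card)])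
    have hle' : (A'.card : ℝ) ≤ A.card + C := by exact_mod_cast hle
    exact (hmax A' (Finset.mem_filter.mpr ⟨Finset.mem_powerset.mpr hA'.subset,
      by linarith, B', hA'⟩)).not_gt hlt

end QL

open QL Filter in
/-- **Theorem D / Theorem 4.4.** A bounded geometry metric space which is a
coarse disjoint union of a sequence of asymptotic expanders is not uniformly locally
amenable. -/
theorem asymptoticExpander_not_ULA {X : Type*} [MetricSpace X]
    (hbg : BoundedGeometry X) (Xn : ℕ → Finset X)
    (hcdu : IsCoarseDisjointUnion Xn)
    (hgrow : Tendsto (fun n => (Xn n).card) atTop atTop)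
    (hexp : IsAsymptoticExpanderSeq Xn) :
    ¬ ULA X := by
  intro hU
  refine hexp.not_forall_nonempty hbg hgrow fun R hR ε hε => ?_
  obtain ⟨S, hS, hE⟩ := hU R hR ε hε
  exact ⟨S, hS, fun F hF _ => hE F hF⟩
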